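/- A unitary U on (ℂ^d)^{⊗n} satisfies CiS[U] = 0 if and only if for every ā ∈ V^n with |ā| = 1, both U P_ā U† and U† P_ā U lie in the complex linear span of the weight-1 Pauli operators { P_b̄ : b̄ ∈ V^n, |b̄| = 1 }. -/

import Mathlib

open Matrix Complex BigOperators
open scoped ComplexOrder
noncomputable section

namespace QC

/-- Operators on the `n`-qudit space `(ℂ^d)^{⊗n}`, as matrices indexed by
computational basis labels `Fin n → Fin d`. -/
abbrev QOp (d n : ℕ) := Matrix (Fin n → Fin d) (Fin n → Fin d) ℂ

/-- The qudit shift operator `X`, with `X|j⟩ = |j+1 mod d⟩`. -/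
def shiftX (d : ℕ) : Matrix (Fin d) (Fin d) ℂ :=
  fun i j => if (i : ℕ) = ((j : ℕ) + 1) % d then 1 else 0

/-- The qudit clock operator `Z`, with `Z|j⟩ = e^{2πij/d}|j⟩`. -/
def clockZ (d : ℕ) : Matrix (Fin d) (Fin d) ℂ :=
  Matrix.diagonal (fun j => Complex.exp (2 * Real.pi * Complex.I * (j : ℕ) / d))

/-- The single-qudit Pauli operator `P_a = X^s Z^t` for `a = (s,t) ∈ ℤ_d × ℤ_d`. -/
def pauli1 (d : ℕ) (a : ZMod d × ZMod d) : Matrix (Fin d) (Fin d) ℂ :=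
  shiftX d ^ a.1.val * clockZ d ^ a.2.val

/-- The `n`-qudit Pauli operator `P_ā = P_{a_1} ⊗ ⋯ ⊗ P_{a_n}`. -/
def pauliN (d n : ℕ) (a : Fin n → ZMod d × ZMod d) : QOp d n :=
  fun x y => ∏ i, pauli1 d (a i) (x i) (y i)

/-- The weight `|ā|`: the number of indices `i` with `a_i ≠ (0,0)`. -/
def weight (d n : ℕ) (a : Fin n → ZMod d × ZMod d) : ℕ :=
  (Finset.univ.filter (fun i => a i ≠ 0)).card

/-- `P_O[ā] = |Tr(O P_ā)|² / d^{2n}`. -/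
def pdist (d n : ℕ) (O : QOp d n) (a : Fin n → ZMod d × ZMod d) : ℝ :=
  ‖(O * pauliN d n a).trace‖ ^ 2 / (d : ℝ) ^ (2 * n)

/-- The normalized 2-norm `‖O‖₂ = (Tr(O†O)/d^n)^{1/2}`. -/
def l2norm (d n : ℕ) (O : QOp d n) : ℝ :=
  Real.sqrt (((Oᴴ * O).trace).re / (d : ℝ) ^ n)

/-- The total influence `I[O] = Σ_ā |ā|·P_O[ā]`. -/
def influence (d n : ℕ) [NeZero d] (O : QOp d n) : ℝ :=
  ∑ a : Fin n → ZMod d × ZMod d, (weight d n a : ℝ) * pdist d n O a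

/-- The local influence `I_j[O] = Σ_{ā : a_j ≠ 0} P_O[ā]`. -/
def localInfluence (d n : ℕ) [NeZero d] (j : Fin n) (O : QOp d n) : ℝ :=
  ∑ a ∈ Finset.univ.filter (fun a : Fin n → ZMod d × ZMod d => a j ≠ 0), pdist d n O a

/-- The quantum Fourier entropy `H[O] = -Σ_ā P_O[ā] log₂ P_O[ā]` (with `0·log 0 = 0`). -/
def qEntropy (d n : ℕ) [NeZero d] (O : QOp d n) : ℝ :=
  -∑ a : Fin n → ZMod d × ZMod d, pdist d n O a * Real.logb 2 (pdist d n O a)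

/-- The binary entropy `h(x) = -x log₂ x - (1-x) log₂ (1-x)`. -/
def binEntropy (x : ℝ) : ℝ :=
  -(x * Real.logb 2 x) - (1 - x) * Real.logb 2 (1 - x)

/-- Circuit sensitivity `CiS[U] = sup { |I[UOU†] - I[O]| : ‖O‖₂ = 1 }`. -/
def CiS (d n : ℕ) [NeZero d] (U : QOp d n) : ℝ :=
  sSup {x : ℝ | ∃ O : QOp d n, l2norm d n O = 1 ∧
    x = |influence d n (U * O * Uᴴ) - influence d n O|}

/-- Magic power `𝓜[U] = sup { |H[UOU†] - H[O]| : ‖O‖₂ = 1 }`. -/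
def magicPower (d n : ℕ) [NeZero d] (U : QOp d n) : ℝ :=
  sSup {x : ℝ | ∃ O : QOp d n, l2norm d n O = 1 ∧
    x = |qEntropy d n (U * O * Uᴴ) - qEntropy d n O|}

/-- Magic entropy `M[U] = max { H[U P_ā U†] : |ā| = 1 }`. -/
def magicEntropy (d n : ℕ) [NeZero d] (U : QOp d n) : ℝ :=
  sSup {x : ℝ | ∃ a : Fin n → ZMod d × ZMod d, weight d n a = 1 ∧
    x = qEntropy d n (U * pauliN d n a * Uᴴ)}

/-- The operator norm `‖A‖∞` (the L2 → L2 operator norm). -/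
def opNorm (d n : ℕ) (A : QOp d n) : ℝ :=
  ‖Matrix.toEuclideanCLM (𝕜 := ℂ) (n := Fin n → Fin d) A‖

/-- The influence rate `R_I(H,O)`. -/
def influenceRate (d n : ℕ) [NeZero d] (H O : QOp d n) : ℂ :=
  (Complex.I / (d : ℂ) ^ (2 * n)) * ∑ a : Fin n → ZMod d × ZMod d, (weight d n a : ℂ) *
    (((O * H - H * O) * pauliN d n a).trace * (O * (pauliN d n a)ᴴ).trace +
     ((O * H - H * O) * (pauliN d n a)ᴴ).trace * (O * pauliN d n a).trace)

/-- The magic rate `R_M(H,O)`. -/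
def magicRate (d n : ℕ) [NeZero d] (H O : QOp d n) : ℂ :=
  (Complex.I / (d : ℂ) ^ (2 * n)) * ∑ a : Fin n → ZMod d × ZMod d,
    (((O * H - H * O) * pauliN d n a).trace * (O * (pauliN d n a)ᴴ).trace +
     ((O * H - H * O) * (pauliN d n a)ᴴ).trace * (O * pauliN d n a).trace) *
    (Real.logb 2 (pdist d n O a) : ℂ)

/-- Extend an operator on the first `k` qudits by the identity: `H₀ ⊗ I`. -/
def extendOp (d k n : ℕ) (h : k ≤ n) (H0 : QOp d k) : QOp d n :=
  fun x y => if ∀ i : Fin n, k ≤ (i : ℕ) → x i = y i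
    then H0 (fun i => x (Fin.castLE h i)) (fun i => y (Fin.castLE h i)) else 0

/-- The tensor product `A ⊗ B` of an `n₁`-qudit and an `n₂`-qudit operator. -/
def tensorOp (d n₁ n₂ : ℕ) (A : QOp d n₁) (B : QOp d n₂) : QOp d (n₁ + n₂) :=
  fun x y => A (fun i => x (Fin.castAdd n₂ i)) (fun i => y (Fin.castAdd n₂ i)) *
             B (fun i => x (Fin.natAdd n₁ i)) (fun i => y (Fin.natAdd n₁ i))

/-- Embed a single-qudit operator `W` at position `j` (identity elsewhere). -/
def embedAt (d n : ℕ) (j : Fin n) (W : Matrix (Fin d) (Fin d) ℂ) : QOp d n :=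
  fun x y => if ∀ i, i ≠ j → x i = y i then W (x j) (y j) else 0

/-- The swap unitary exchanging qudits `i` and `j`. -/
def swapOp (d n : ℕ) (i j : Fin n) : QOp d n :=
  fun x y => if x = y ∘ Equiv.swap i j then 1 else 0

/-- The qubit Pauli X matrix. -/
def pauliX : Matrix (Fin 2) (Fin 2) ℂ := !![0, 1; 1, 0]

/-- The qubit Pauli Y matrix. -/
def pauliY : Matrix (Fin 2) (Fin 2) ℂ := !![0, -Complex.I; Complex.I, 0]

/-- The qubit Pauli Z matrix. -/
def pauliZ : Matrix (Fin 2) (Fin 2) ℂ := !![1, 0; 0, -1]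

/-- The ordered product `γ^S = ∏_{i∈S} γ_i` (factors in increasing index order). -/
def gammaProd (n : ℕ) (γ : Fin (2 * n) → QOp 2 n) (S : Finset (Fin (2 * n))) : QOp 2 n :=
  ((S.sort (· ≤ ·)).map γ).prod

/-- `P^G_O[S] = |Tr((γ^S)† O)|² / 2^{2n}`. -/
def pdistG (n : ℕ) (γ : Fin (2 * n) → QOp 2 n) (O : QOp 2 n) (S : Finset (Fin (2 * n))) : ℝ :=
  ‖((gammaProd n γ S)ᴴ * O).trace‖ ^ 2 / (2 : ℝ) ^ (2 * n)

/-- The Gaussian influence `I^G[O] = Σ_S |S|·P^G_O[S]`. -/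
def influenceG (n : ℕ) (γ : Fin (2 * n) → QOp 2 n) (O : QOp 2 n) : ℝ :=
  ∑ S : Finset (Fin (2 * n)), (S.card : ℝ) * pdistG n γ O S

/-- The Gaussian Fourier entropy `H^G[O] = -Σ_S P^G_O[S] log₂ P^G_O[S]`. -/
def entropyG (n : ℕ) (γ : Fin (2 * n) → QOp 2 n) (O : QOp 2 n) : ℝ :=
  -∑ S : Finset (Fin (2 * n)), pdistG n γ O S * Real.logb 2 (pdistG n γ O S)

/-- Gaussian circuit sensitivity `CiS^G[U] = sup { |I^G[UOU†] - I^G[O]| : ‖O‖₂ = 1 }`. -/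
def CiSG (n : ℕ) (γ : Fin (2 * n) → QOp 2 n) (U : QOp 2 n) : ℝ :=
  sSup {x : ℝ | ∃ O : QOp 2 n, l2norm 2 n O = 1 ∧
    x = |influenceG n γ (U * O * Uᴴ) - influenceG n γ O|}

/-- Fourier coefficient `f̂(S)` of a Boolean function `f : {-1,1}^n → ℝ`, with
the domain encoded as `Fin n → Bool` (`true ↦ -1`, `false ↦ 1`). -/
def fourierCoeff (n : ℕ) (f : (Fin n → Bool) → ℝ) (S : Finset (Fin n)) : ℝ :=
  (∑ x : Fin n → Bool, f x * ∏ i ∈ S, (if x i then -1 else 1)) / 2 ^ n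

/-- Fourier entropy of a Boolean function. -/
def boolEntropy (n : ℕ) (f : (Fin n → Bool) → ℝ) : ℝ :=
  -∑ S : Finset (Fin n), (fourierCoeff n f S) ^ 2 * Real.logb 2 ((fourierCoeff n f S) ^ 2)

/-- Total influence of a Boolean function. -/
def boolInfluence (n : ℕ) (f : (Fin n → Bool) → ℝ) : ℝ :=
  ∑ S : Finset (Fin n), (S.card : ℝ) * (fourierCoeff n f S) ^ 2

/-- The completely dephasing channel `Δ`. -/
def dephase (d n : ℕ) (A : QOp d n) : QOp d n :=
  Matrix.diagonal (fun i => A i i)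

/-- The diagonal matrix `log₂ Δ(ρ)` (entrywise base-2 logarithm of the diagonal). -/
def logDephase (d n : ℕ) (A : QOp d n) : QOp d n :=
  Matrix.diagonal (fun i => (Real.logb 2 (A i i).re : ℂ))

/-- The coherence rate `R_C(H,ρ) = -i Tr([ρ, log Δ(ρ)] H)`. -/
def cohRate (d n : ℕ) (H ρ : QOp d n) : ℂ :=
  -Complex.I * ((ρ * logDephase d n ρ - logDephase d n ρ * ρ) * H).trace

/-- The max-relative entropy `D_max(ρ‖σ) = log₂ min{λ > 0 : ρ ≤ λσ}`. -/
def Dmax (d n : ℕ) (ρ σ : QOp d n) : ℝ :=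
  Real.logb 2 (sInf {l : ℝ | 0 < l ∧ ((l : ℂ) • σ - ρ).PosSemidef})

/-- Computational basis labels, identified with `ZMod d`. -/
def labelEquiv (d : ℕ) [NeZero d] : Fin d ≃ ZMod d :=
  Equiv.ofBijective (fun i => ((i : ℕ) : ZMod d)) <| by
    rw [Fintype.bijective_iff_injective_and_card]
    refine ⟨fun i j h => ?_, by simp⟩
    have h' := (ZMod.natCast_eq_natCast_iff' _ _ _).1 h
    rw [Nat.mod_eq_of_lt i.2, Nat.mod_eq_of_lt j.2] at h'
    exact Fin.ext h'

lemma labelEquiv_apply (d : ℕ) [NeZero d] (i : Fin d) :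
    labelEquiv d i = ((i : ℕ) : ZMod d) := rfl

/-- The Pauli operator `X^s Z^t` with rows and columns labelled by `ZMod d`. -/
def pauliZMod (d : ℕ) [NeZero d] (a : ZMod d × ZMod d) : Matrix (ZMod d) (ZMod d) ℂ :=
  fun i j => if i = j + a.1 then ZMod.stdAddChar (a.2 * j) else 0

lemma shiftX_pow_apply (d : ℕ) [NeZero d] (s : ℕ) (i j : Fin d) :
    (shiftX d ^ s) i j = if labelEquiv d i = labelEquiv d j + (s : ZMod d) then 1 else 0 := by
  induction s generalizing i j with
  | zero => simp [Matrix.one_apply]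
  | succ s ih =>
    have key : ∀ k : Fin d, shiftX d k j =
        if k = (labelEquiv d).symm (labelEquiv d j + 1) then 1 else 0 := by
      intro k
      refine if_congr ?_ rfl rfl
      rw [Equiv.eq_symm_apply, labelEquiv_apply, labelEquiv_apply]
      have := ZMod.natCast_eq_natCast_iff' (k : ℕ) ((j : ℕ) + 1) d
      rw [Nat.mod_eq_of_lt k.2] at this
      push_cast at this
      exact this.symm
    rw [pow_succ, Matrix.mul_apply]
    simp only [key, mul_ite, mul_one, mul_zero, Finset.sum_ite_eq', Finset.mem_univ,
      if_true]
    rw [ih, Equiv.apply_symm_apply]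
    push_cast
    rw [add_assoc, add_comm (1 : ZMod d)]

lemma pauli1_eq_submatrix (d : ℕ) [NeZero d] (a : ZMod d × ZMod d) :
    pauli1 d a = (pauliZMod d a).submatrix (labelEquiv d) (labelEquiv d) := by
  ext i j
  have hz : ∀ j : Fin d, Complex.exp (2 * Real.pi * Complex.I * (j : ℕ) / d) =
      ZMod.stdAddChar (labelEquiv d j) := by
    intro j
    rw [labelEquiv_apply]
    have := ZMod.stdAddChar_coe (N := d) ((j : ℕ) : ℤ)
    push_cast at this
    exact this.symm
  simp only [pauli1, clockZ, Matrix.diagonal_pow, Matrix.mul_diagonal, shiftX_pow_apply,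
    ZMod.natCast_val, ZMod.cast_id', id, Pi.pow_apply, hz, Matrix.submatrix_apply, pauliZMod]
  rw [← AddChar.map_nsmul_eq_pow, nsmul_eq_mul, ZMod.natCast_val, ZMod.cast_id', id]
  simp

/-- The commutation phase of two single-qudit Pauli operators. -/
def commPhase (d : ℕ) [NeZero d] (b a : ZMod d × ZMod d) : ℂ :=
  ZMod.stdAddChar (b.2 * a.1 - a.2 * b.1)

lemma commPhase_zero_left (d : ℕ) [NeZero d] (a : ZMod d × ZMod d) : commPhase d 0 a = 1 := by
  simp [commPhase]

lemma pauliZMod_mul_comm (d : ℕ) [NeZero d] (b a : ZMod d × ZMod d) :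
    pauliZMod d b * pauliZMod d a = commPhase d b a • (pauliZMod d a * pauliZMod d b) := by
  ext i j
  simp only [Matrix.smul_apply, Matrix.mul_apply, pauliZMod, mul_ite, mul_zero,
    Finset.sum_ite_eq', Finset.mem_univ, if_true, ite_mul, zero_mul, smul_eq_mul, commPhase]
  rw [add_right_comm]
  split_ifs
  · simp only [← AddChar.map_add_eq_mul]
    congr 1
    ring
  · rfl

lemma stdAddChar_star (d : ℕ) [NeZero d] (x : ZMod d) :
    star (ZMod.stdAddChar x : ℂ) = ZMod.stdAddChar (-x) := by
  rw [AddChar.map_neg_eq_conj]; rfl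

lemma pauliZMod_mul_conjTranspose (d : ℕ) [NeZero d] (a : ZMod d × ZMod d) :
    pauliZMod d a * (pauliZMod d a)ᴴ = 1 := by
  ext i j
  have h : ∀ k : ZMod d, (i = k + a.1) ↔ k = i - a.1 := fun k =>
    ⟨fun h => by rw [h]; ring, fun h => by rw [h]; ring⟩
  simp only [Matrix.mul_apply, Matrix.conjTranspose_apply, pauliZMod, h, ite_mul, zero_mul,
    Finset.sum_ite_eq', Finset.mem_univ, if_true, sub_add_cancel, Matrix.one_apply, @eq_comm _ i j]
  split_ifs
  · rw [stdAddChar_star, ← AddChar.map_add_eq_mul]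
    simp
  · simp

lemma sum_stdAddChar_mul (d : ℕ) [NeZero d] (b : ZMod d) :
    ∑ x : ZMod d, (ZMod.stdAddChar (b * x) : ℂ) = if b = 0 then (d : ℂ) else 0 := by
  have := AddChar.sum_mulShift b (ZMod.isPrimitive_stdAddChar d)
  simpa [mul_comm, ZMod.card] using this

lemma trace_conjTranspose_pauliZMod_mul (d : ℕ) [NeZero d] (a b : ZMod d × ZMod d) :
    ((pauliZMod d a)ᴴ * pauliZMod d b).trace = if a = b then (d : ℂ) else 0 := by
  have h : ∀ j : ZMod d, ((pauliZMod d a)ᴴ * pauliZMod d b) j j =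
      if a.1 = b.1 then (ZMod.stdAddChar ((b.2 - a.2) * j) : ℂ) else 0 := by
    intro j
    simp only [Matrix.mul_apply, Matrix.conjTranspose_apply, pauliZMod, mul_ite, mul_zero,
      Finset.sum_ite_eq', Finset.mem_univ, if_true, add_right_inj, @eq_comm _ b.1]
    split_ifs
    · rw [stdAddChar_star, ← AddChar.map_add_eq_mul]
      congr 1
      ring
    · simp
  simp only [Matrix.trace, Matrix.diag_apply, h]
  by_cases h1 : a.1 = b.1
  · simp [h1, sum_stdAddChar_mul, sub_eq_zero, Prod.ext_iff, eq_comm]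
  · simp [h1, Prod.ext_iff]

lemma sum_commPhase (d : ℕ) [NeZero d] (a : ZMod d × ZMod d) :
    ∑ b, commPhase d b a = if a = 0 then (d : ℂ) ^ 2 else 0 := by
  have h : ∀ b : ZMod d × ZMod d, commPhase d b a =
      ZMod.stdAddChar (-a.2 * b.1) * ZMod.stdAddChar (a.1 * b.2) := by
    intro b
    rw [commPhase, ← AddChar.map_add_eq_mul]
    congr 1
    ring
  simp only [h, Fintype.sum_prod_type, ← Finset.mul_sum, ← Finset.sum_mul, sum_stdAddChar_mul]
  by_cases h1 : a.1 = 0 <;> by_cases h2 : a.2 = 0 <;> simp [h1, h2, Prod.ext_iff, sq]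

lemma norm_commPhase (d : ℕ) [NeZero d] (b a : ZMod d × ZMod d) : ‖commPhase d b a‖ = 1 :=
  AddChar.norm_apply _ _

lemma sum_norm_commPhase_sub_one (d : ℕ) [NeZero d] (a : ZMod d × ZMod d) :
    ∑ b, ‖commPhase d b a - 1‖ ^ 2 = if a = 0 then 0 else 2 * (d : ℝ) ^ 2 := by
  have h : ∀ b, ‖commPhase d b a - 1‖ ^ 2 = 2 - 2 * (commPhase d b a).re := by
    intro b
    have h1 := norm_commPhase d b a
    rw [← sq_eq_sq₀ (norm_nonneg _) zero_le_one, ← Complex.normSq_eq_norm_sq,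
      Complex.normSq_apply] at h1
    rw [← Complex.normSq_eq_norm_sq, Complex.normSq_apply]
    simp only [Complex.sub_re, Complex.sub_im, Complex.one_re, Complex.one_im]
    linarith
  simp only [h, Finset.sum_sub_distrib, ← Finset.mul_sum, ← Complex.re_sum, sum_commPhase]
  split_ifs
  · simp [ZMod.card, ← Complex.ofReal_natCast, ← Complex.ofReal_pow]
    ring
  · simp [ZMod.card]
    ring

section Pauli1

variable (d : ℕ) [NeZero d] (a b : ZMod d × ZMod d)

lemma pauli1_mul_comm :
    pauli1 d b * pauli1 d a = commPhase d b a • (pauli1 d a * pauli1 d b) := by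
  simp only [pauli1_eq_submatrix, Matrix.submatrix_mul_equiv, pauliZMod_mul_comm d b a,
    Matrix.submatrix_smul, Pi.smul_apply]

lemma pauli1_mul_conjTranspose : pauli1 d a * (pauli1 d a)ᴴ = 1 := by
  simp [pauli1_eq_submatrix, Matrix.conjTranspose_submatrix, Matrix.submatrix_mul_equiv,
    pauliZMod_mul_conjTranspose]

lemma trace_conjTranspose_pauli1_mul :
    ((pauli1 d a)ᴴ * pauli1 d b).trace = if a = b then (d : ℂ) else 0 := by
  rw [← trace_conjTranspose_pauliZMod_mul]
  simp only [pauli1_eq_submatrix, Matrix.conjTranspose_submatrix, Matrix.submatrix_mul_equiv]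
  exact Equiv.sum_comp (labelEquiv d) (fun i => ((pauliZMod d a)ᴴ * pauliZMod d b) i i)

end Pauli1

/-- The tensor product of a family of single-qudit operators. -/
def tensorFamily (d n : ℕ) (A : Fin n → Matrix (Fin d) (Fin d) ℂ) : QOp d n :=
  fun x y => ∏ i, A i (x i) (y i)

lemma pauliN_eq_tensorFamily (d n : ℕ) (a : Fin n → ZMod d × ZMod d) :
    pauliN d n a = tensorFamily d n (fun i => pauli1 d (a i)) := rfl

section TensorFamily

variable {d n : ℕ} (A B : Fin n → Matrix (Fin d) (Fin d) ℂ)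

lemma tensorFamily_mul :
    tensorFamily d n A * tensorFamily d n B = tensorFamily d n (fun i => A i * B i) := by
  ext x y
  simp only [Matrix.mul_apply, tensorFamily, ← Finset.prod_mul_distrib]
  rw [Finset.prod_univ_sum, Fintype.piFinset_univ]

lemma trace_tensorFamily : (tensorFamily d n A).trace = ∏ i, (A i).trace := by
  simp only [Matrix.trace, Matrix.diag_apply, tensorFamily]
  rw [Finset.prod_univ_sum, Fintype.piFinset_univ]

lemma conjTranspose_tensorFamily :
    (tensorFamily d n A)ᴴ = tensorFamily d n (fun i => (A i)ᴴ) := by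
  ext x y
  simp [tensorFamily, Matrix.conjTranspose_apply]

lemma tensorFamily_one : tensorFamily d n (fun _ => 1) = 1 := by
  ext x y
  simp only [tensorFamily, Matrix.one_apply, Finset.prod_ite_zero, Finset.prod_const_one,
    Finset.mem_univ, true_implies, funext_iff]

lemma tensorFamily_smul (c : Fin n → ℂ) :
    tensorFamily d n (fun i => c i • A i) = (∏ i, c i) • tensorFamily d n A := by
  ext x y
  simp [tensorFamily, Finset.prod_mul_distrib]

end TensorFamily

section PauliN

variable (d n : ℕ) [NeZero d] (a b : Fin n → ZMod d × ZMod d)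

lemma pauliN_zero : pauliN d n 0 = 1 := by
  rw [pauliN_eq_tensorFamily, ← tensorFamily_one]
  simp [pauli1]

lemma pauliN_mul_comm :
    pauliN d n b * pauliN d n a =
      (∏ i, commPhase d (b i) (a i)) • (pauliN d n a * pauliN d n b) := by
  simp only [pauliN_eq_tensorFamily, tensorFamily_mul, ← tensorFamily_smul]
  simp only [← pauli1_mul_comm]

lemma pauliN_mul_conjTranspose : pauliN d n a * (pauliN d n a)ᴴ = 1 := by
  simp only [pauliN_eq_tensorFamily, conjTranspose_tensorFamily, tensorFamily_mul,
    pauli1_mul_conjTranspose, tensorFamily_one]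

lemma conjTranspose_pauliN_mul : (pauliN d n a)ᴴ * pauliN d n a = 1 :=
  mul_eq_one_comm.1 (pauliN_mul_conjTranspose d n a)

lemma trace_conjTranspose_pauliN_mul :
    ((pauliN d n a)ᴴ * pauliN d n b).trace = if a = b then (d : ℂ) ^ n else 0 := by
  simp only [pauliN_eq_tensorFamily, conjTranspose_tensorFamily, tensorFamily_mul,
    trace_tensorFamily, trace_conjTranspose_pauli1_mul, Finset.prod_ite_zero, Finset.mem_univ,
    true_implies, Finset.prod_const, Finset.card_univ, Fintype.card_fin]
  exact if_congr funext_iff.symm rfl rfl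

/-- Every operator is the sum of its Pauli components. -/
lemma pauliN_expansion (O : QOp d n) :
    O = ∑ a, (((pauliN d n a)ᴴ * O).trace / (d : ℂ) ^ n) • pauliN d n a := by
  have hN : (d : ℂ) ^ n ≠ 0 := pow_ne_zero _ (Nat.cast_ne_zero.2 (NeZero.ne d))
  have coeff : ∀ (c : (Fin n → ZMod d × ZMod d) → ℂ) (b : Fin n → ZMod d × ZMod d),
      ((pauliN d n b)ᴴ * ∑ a, c a • pauliN d n a).trace = c b * (d : ℂ) ^ n := by
    intro c b
    simp [Matrix.mul_sum, Matrix.trace_sum, trace_conjTranspose_pauliN_mul]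
  have hli : LinearIndependent ℂ (pauliN d n) := by
    rw [Fintype.linearIndependent_iff]
    intro c hc b
    have := coeff c b
    rw [hc] at this
    simpa [hN] using this.symm
  have hspan := hli.span_eq_top_of_card_eq_finrank' (by
    rw [Module.finrank_matrix]
    simp [ZMod.card, mul_pow])
  have hO : O ∈ Submodule.span ℂ (Set.range (pauliN d n)) := by rw [hspan]; trivial
  obtain ⟨c, rfl⟩ := (Submodule.mem_span_range_iff_exists_fun ℂ).1 hO
  simp only [coeff, mul_div_cancel_right₀ _ hN]

end PauliN

/-- The squared normalized 2-norm of an operator. -/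
def sqNorm (d n : ℕ) (O : QOp d n) : ℝ := ((Oᴴ * O).trace).re / (d : ℝ) ^ n

lemma sum_pdist (d n : ℕ) [NeZero d] (O : QOp d n) :
    ∑ a, pdist d n O a = sqNorm d n O := by
  have hN : (d : ℝ) ^ n ≠ 0 := pow_ne_zero _ (Nat.cast_ne_zero.2 (NeZero.ne d))
  have h : (Oᴴ * O).trace =
      ((∑ a, ‖(O * pauliN d n a).trace‖ ^ 2 / (d : ℝ) ^ n : ℝ) : ℂ) := by
    conv_lhs => rw [pauliN_expansion d n Oᴴ]
    rw [Finset.sum_mul, Matrix.trace_sum, Complex.ofReal_sum]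
    refine Finset.sum_congr rfl fun a _ => ?_
    rw [Matrix.smul_mul, Matrix.trace_smul, ← Matrix.conjTranspose_mul,
      Matrix.trace_conjTranspose, Matrix.trace_mul_comm (pauliN d n a) O, smul_eq_mul,
      div_mul_eq_mul_div]
    push_cast
    rw [← Complex.conj_mul']
    rfl
  rw [sqNorm, h, Complex.ofReal_re, Finset.sum_div]
  refine Finset.sum_congr rfl fun a _ => ?_
  rw [pdist, div_div, two_mul, pow_add]

lemma pdist_nonneg (d n : ℕ) (O : QOp d n) (a : Fin n → ZMod d × ZMod d) :
    0 ≤ pdist d n O a := by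
  unfold pdist; positivity

lemma l2norm_eq_one_iff (d n : ℕ) (O : QOp d n) : l2norm d n O = 1 ↔ sqNorm d n O = 1 :=
  Real.sqrt_eq_one

lemma influence_nonneg (d n : ℕ) [NeZero d] (O : QOp d n) : 0 ≤ influence d n O :=
  Finset.sum_nonneg fun a _ => mul_nonneg (Nat.cast_nonneg _) (pdist_nonneg d n O a)

lemma influence_le (d n : ℕ) [NeZero d] (O : QOp d n) :
    influence d n O ≤ n * sqNorm d n O := by
  rw [← sum_pdist, Finset.mul_sum]
  refine Finset.sum_le_sum fun a _ => mul_le_mul_of_nonneg_right ?_ (pdist_nonneg d n O a)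
  exact_mod_cast (Finset.card_le_univ _).trans_eq (Fintype.card_fin n)

lemma sqNorm_mul_left {d n : ℕ} {U : QOp d n} (hU : Uᴴ * U = 1) (A : QOp d n) :
    sqNorm d n (U * A) = sqNorm d n A := by
  rw [sqNorm, sqNorm, Matrix.conjTranspose_mul, Matrix.mul_assoc, ← Matrix.mul_assoc Uᴴ, hU,
    Matrix.one_mul]

lemma sqNorm_mul_right {d n : ℕ} {U : QOp d n} (hU : U * Uᴴ = 1) (A : QOp d n) :
    sqNorm d n (A * U) = sqNorm d n A := by
  rw [sqNorm, sqNorm, Matrix.conjTranspose_mul, Matrix.mul_assoc, Matrix.trace_mul_comm,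
    Matrix.mul_assoc, Matrix.mul_assoc, hU, Matrix.mul_one]

lemma sqNorm_conj {d n : ℕ} {U : QOp d n} (hU : Uᴴ * U = 1) (A : QOp d n) :
    sqNorm d n (U * A * Uᴴ) = sqNorm d n A := by
  rw [sqNorm_mul_right (by rwa [Matrix.conjTranspose_conjTranspose]), sqNorm_mul_left hU]

lemma influence_conj_eq_of_CiS_eq_zero {d n : ℕ} [NeZero d] {U : QOp d n} (hU : Uᴴ * U = 1)
    (h : CiS d n U = 0) {O : QOp d n} (hO : sqNorm d n O = 1) :
    influence d n (U * O * Uᴴ) = influence d n O := by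
  have hbdd : BddAbove {x : ℝ | ∃ O : QOp d n, l2norm d n O = 1 ∧
      x = |influence d n (U * O * Uᴴ) - influence d n O|} := by
    refine ⟨n, ?_⟩
    rintro _ ⟨A, hA, rfl⟩
    rw [l2norm_eq_one_iff] at hA
    have h1 := influence_le d n A
    have h2 := influence_le d n (U * A * Uᴴ)
    have h3 := influence_nonneg d n A
    have h4 := influence_nonneg d n (U * A * Uᴴ)
    rw [sqNorm_conj hU] at h2
    rw [hA, mul_one] at h1 h2
    rw [abs_le]
    constructor <;> linarith
  have := le_csSup hbdd ⟨O, (l2norm_eq_one_iff d n O).2 hO, rfl⟩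
  rw [← CiS, h] at this
  exact sub_eq_zero.1 (abs_nonpos_iff.1 this)

lemma weight_eq_zero_iff {d n : ℕ} (a : Fin n → ZMod d × ZMod d) :
    weight d n a = 0 ↔ a = 0 := by
  simp [weight, Finset.filter_eq_empty_iff, funext_iff]

/-- An operator whose adjoint is traceless, normalized and of influence `1` is a combination of
weight-one Pauli operators. -/
lemma mem_span_weight_one {d n : ℕ} [NeZero d] {A : QOp d n} (hA : sqNorm d n Aᴴ = 1)
    (htr : A.trace = 0) (hI : influence d n Aᴴ = 1) :
    A ∈ Submodule.span ℂ {M : QOp d n | ∃ b, weight d n b = 1 ∧ M = pauliN d n b} := by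
  have hN : (d : ℝ) ^ (2 * n) ≠ 0 := pow_ne_zero _ (Nat.cast_ne_zero.2 (NeZero.ne d))
  have hz : pdist d n Aᴴ 0 = 0 := by
    rw [pdist, pauliN_zero, Matrix.mul_one, Matrix.trace_conjTranspose, htr]
    simp
  have hnn : ∀ a, 0 ≤ ((weight d n a : ℝ) - 1) * pdist d n Aᴴ a := by
    intro a
    by_cases ha : a = 0
    · rw [ha, hz, mul_zero]
    · have : 1 ≤ weight d n a := Nat.one_le_iff_ne_zero.2 (mt (weight_eq_zero_iff a).1 ha)
      refine mul_nonneg (sub_nonneg.2 (by exact_mod_cast this)) (pdist_nonneg _ _ _ _)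
  have hsum : ∑ a, ((weight d n a : ℝ) - 1) * pdist d n Aᴴ a = 0 := by
    simp only [sub_mul, one_mul, Finset.sum_sub_distrib, sum_pdist, hA]
    rw [← influence, hI, sub_self]
  rw [Finset.sum_eq_zero_iff_of_nonneg fun a _ => hnn a] at hsum
  rw [pauliN_expansion d n A]
  refine Submodule.sum_mem _ fun a _ => ?_
  by_cases ha : weight d n a = 1
  · exact Submodule.smul_mem _ _ (Submodule.subset_span ⟨a, ha, rfl⟩)
  · have h := (mul_eq_zero.1 (hsum a (Finset.mem_univ a))).resolve_left
      (sub_ne_zero.2 (by exact_mod_cast ha))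
    have h' : (Aᴴ * pauliN d n a).trace = 0 := by
      simpa [pdist, NeZero.ne d] using h
    have h'' : ((pauliN d n a)ᴴ * A).trace = 0 := by
      rw [← star_eq_zero, ← Matrix.trace_conjTranspose, Matrix.conjTranspose_mul,
        Matrix.conjTranspose_conjTranspose, h']
    rw [h'', zero_div, zero_smul]
    exact Submodule.zero_mem _

lemma pdist_conjTranspose_pauliN (d n : ℕ) [NeZero d] (a b : Fin n → ZMod d × ZMod d) :
    pdist d n (pauliN d n b)ᴴ a = if b = a then 1 else 0 := by
  rw [pdist, trace_conjTranspose_pauliN_mul]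
  have : (d : ℝ) ≠ 0 := Nat.cast_ne_zero.2 (NeZero.ne d)
  split_ifs
  · rw [norm_pow, Complex.norm_natCast, ← pow_mul, mul_comm n 2, div_self (pow_ne_zero _ this)]
  · simp

lemma sqNorm_conjTranspose_pauliN (d n : ℕ) [NeZero d] (b : Fin n → ZMod d × ZMod d) :
    sqNorm d n (pauliN d n b)ᴴ = 1 := by
  simp [← sum_pdist, pdist_conjTranspose_pauliN]

lemma influence_conjTranspose_pauliN (d n : ℕ) [NeZero d] (b : Fin n → ZMod d × ZMod d) :
    influence d n (pauliN d n b)ᴴ = weight d n b := by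
  simp [influence, pdist_conjTranspose_pauliN]

lemma trace_pauliN_eq_zero (d n : ℕ) [NeZero d] {b : Fin n → ZMod d × ZMod d}
    (hb : weight d n b = 1) : (pauliN d n b).trace = 0 := by
  have h := trace_conjTranspose_pauliN_mul d n 0 b
  rw [pauliN_zero, Matrix.conjTranspose_one, Matrix.one_mul, if_neg] at h
  · exact h
  · rintro rfl
    rw [(weight_eq_zero_iff _).2 rfl] at hb
    exact zero_ne_one hb

/-- Labels of the weight-one Pauli operators: a site and a nontrivial phase-space point. -/
abbrev SiteLabel (d n : ℕ) := Fin n × {v : ZMod d × ZMod d // v ≠ 0}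

/-- The weight-one Pauli index with the given site label. -/
def siteIndex {d n : ℕ} (k : SiteLabel d n) : Fin n → ZMod d × ZMod d :=
  Pi.single k.1 k.2.1

lemma siteIndex_injective {d n : ℕ} : Function.Injective (siteIndex (d := d) (n := n)) := by
  rintro ⟨j, v, hv⟩ ⟨k, w, hw⟩ h
  simp only [siteIndex] at h
  have hjk : j = k := by
    by_contra hne
    have := congrFun h j
    rw [Pi.single_eq_same, Pi.single_eq_of_ne hne] at this
    exact hv this
  subst hjk
  simpa using Pi.single_injective j h

lemma weight_eq_one_iff {d n : ℕ} (b : Fin n → ZMod d × ZMod d) :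
    weight d n b = 1 ↔ ∃ k : SiteLabel d n, siteIndex k = b := by
  rw [weight, Finset.card_eq_one]
  constructor
  · rintro ⟨j, hj⟩
    have hmem : ∀ i, b i ≠ 0 ↔ i = j := by
      intro i
      have := Finset.ext_iff.1 hj i
      simpa using this
    refine ⟨(j, ⟨b j, (hmem j).2 rfl⟩), funext fun i => ?_⟩
    by_cases hi : i = j
    · subst hi; simp [siteIndex]
    · rw [siteIndex, Pi.single_eq_of_ne hi]
      exact (not_not.1 (mt (hmem i).1 hi)).symm
  · rintro ⟨⟨j, v, hv⟩, rfl⟩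
    refine ⟨j, ?_⟩
    ext i
    rw [Finset.mem_filter_univ, Finset.mem_singleton, siteIndex]
    by_cases hi : i = j
    · subst hi
      rw [Pi.single_eq_same]
      exact iff_of_true hv rfl
    · rw [Pi.single_eq_of_ne hi]
      exact iff_of_false (not_not.2 rfl) hi

/-- The influence is the normalized sum of squared norms of commutators with weight-one Paulis. -/
lemma sum_sqNorm_commutator (d n : ℕ) [NeZero d] (O : QOp d n) :
    ∑ k : SiteLabel d n, sqNorm d n
      (pauliN d n (siteIndex k) * O - O * pauliN d n (siteIndex k)) =
    2 * (d : ℝ) ^ 2 * influence d n O := by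
  have hk : ∀ k : SiteLabel d n, sqNorm d n
      (pauliN d n (siteIndex k) * O - O * pauliN d n (siteIndex k)) =
      ∑ a, ‖commPhase d k.2.1 (a k.1) - 1‖ ^ 2 * pdist d n O a := by
    intro k
    set P := pauliN d n (siteIndex k) with hP
    have hPP : Pᴴ * P = 1 := conjTranspose_pauliN_mul _ _ _
    have hPP' : P * Pᴴ = 1 := pauliN_mul_conjTranspose _ _ _
    have hfac : P * O - O * P = P * (O - Pᴴ * O * P) := by
      rw [Matrix.mul_sub, ← Matrix.mul_assoc, ← Matrix.mul_assoc, hPP', Matrix.one_mul]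
    rw [hfac, sqNorm_mul_left hPP, ← sum_pdist]
    refine Finset.sum_congr rfl fun a _ => ?_
    have hphase : ∏ i, commPhase d (siteIndex k i) (a i) = commPhase d k.2.1 (a k.1) := by
      rw [Finset.prod_eq_single k.1]
      · simp [siteIndex]
      · intro i _ hi
        rw [siteIndex, Pi.single_eq_of_ne hi, commPhase_zero_left]
      · simp
    have hconj : P * pauliN d n a * Pᴴ = commPhase d k.2.1 (a k.1) • pauliN d n a := by
      rw [hP, pauliN_mul_comm, hphase, Matrix.smul_mul, Matrix.mul_assoc,
        pauliN_mul_conjTranspose, Matrix.mul_one]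
    have htr : ((O - Pᴴ * O * P) * pauliN d n a).trace =
        (1 - commPhase d k.2.1 (a k.1)) * (O * pauliN d n a).trace := by
      have : (Pᴴ * O * P * pauliN d n a).trace =
          commPhase d k.2.1 (a k.1) * (O * pauliN d n a).trace := by
        rw [Matrix.mul_assoc, Matrix.mul_assoc, Matrix.trace_mul_comm, Matrix.mul_assoc, hconj,
          Matrix.mul_smul, Matrix.trace_smul, smul_eq_mul]
      rw [Matrix.sub_mul, Matrix.trace_sub, this]
      ring
    rw [pdist, htr, norm_mul, mul_pow, norm_sub_rev, mul_div_assoc, ← pdist]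
  have hsite : ∀ c : ZMod d × ZMod d,
      ∑ v : {v : ZMod d × ZMod d // v ≠ 0}, ‖commPhase d v.1 c - 1‖ ^ 2 =
      if c ≠ 0 then 2 * (d : ℝ) ^ 2 else 0 := by
    intro c
    have h := sum_norm_commPhase_sub_one d c
    rw [Fintype.sum_eq_add_sum_subtype_ne _ 0, commPhase_zero_left, sub_self, norm_zero] at h
    rw [ite_not, ← h]
    simp
  simp only [hk]
  rw [Finset.sum_comm, influence, Finset.mul_sum]
  refine Finset.sum_congr rfl fun a _ => ?_
  rw [← Finset.sum_mul, Fintype.sum_prod_type, ← mul_assoc]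
  simp only [hsite]
  congr 1
  rw [← Finset.sum_filter, Finset.sum_const, nsmul_eq_mul, weight, mul_comm]

/-- A sum of squared norms is unchanged by an isometric mixing of the summands. -/
lemma sum_sqNorm_mix {d n : ℕ} {ι : Type*} [Fintype ι] [DecidableEq ι] {M : Matrix ι ι ℂ}
    (hM : Mᴴ * M = 1) (D : ι → QOp d n) :
    ∑ k, sqNorm d n (∑ l, M k l • D l) = ∑ l, sqNorm d n (D l) := by
  simp only [sqNorm, ← Finset.sum_div, ← Complex.re_sum]
  congr 2
  have hent : ∀ l l', ∑ k, star (M k l) * M k l' = if l = l' then 1 else 0 := by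
    intro l l'
    have := congrFun (congrFun hM l) l'
    simpa [Matrix.mul_apply, Matrix.one_apply] using this
  calc ∑ k, ((∑ l, M k l • D l)ᴴ * ∑ l, M k l • D l).trace
      = ∑ k, ∑ l, ∑ l', (star (M k l) * M k l') * ((D l)ᴴ * D l').trace := by
        refine Finset.sum_congr rfl fun k _ => ?_
        simp only [Matrix.conjTranspose_sum, Matrix.conjTranspose_smul, Finset.sum_mul,
          Finset.mul_sum, Matrix.trace_sum, Matrix.smul_mul, Matrix.mul_smul, Matrix.trace_smul,
          smul_eq_mul]
        rw [Finset.sum_comm]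
        refine Finset.sum_congr rfl fun l _ => Finset.sum_congr rfl fun l' _ => ?_
        ring
    _ = ∑ l, ∑ l', (∑ k, star (M k l) * M k l') * ((D l)ᴴ * D l').trace := by
        rw [Finset.sum_comm]
        refine Finset.sum_congr rfl fun l _ => ?_
        rw [Finset.sum_comm]
        simp only [Finset.sum_mul]
    _ = ∑ l, ((D l)ᴴ * D l).trace := by
        simp only [hent, ite_mul, one_mul, zero_mul, Finset.sum_ite_eq, Finset.mem_univ, if_true]

/-- Conjugation by a unitary preserving the weight-one span preserves the influence. -/
lemma influence_conj_eq {d n : ℕ} [NeZero d] {U : QOp d n} (hU : Uᴴ * U = 1)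
    (h : ∀ a, weight d n a = 1 → Uᴴ * pauliN d n a * U ∈
      Submodule.span ℂ {M : QOp d n | ∃ b, weight d n b = 1 ∧ M = pauliN d n b})
    (O : QOp d n) : influence d n (U * O * Uᴴ) = influence d n O := by
  have hU' : U * Uᴴ = 1 := mul_eq_one_comm.1 hU
  have hd : (d : ℂ) ≠ 0 := Nat.cast_ne_zero.2 (NeZero.ne d)
  have hset : {M : QOp d n | ∃ b, weight d n b = 1 ∧ M = pauliN d n b} =
      Set.range (fun k : SiteLabel d n => pauliN d n (siteIndex k)) := by
    ext A
    constructor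
    · rintro ⟨b, hb, rfl⟩
      obtain ⟨k, rfl⟩ := (weight_eq_one_iff b).1 hb
      exact ⟨k, rfl⟩
    · rintro ⟨k, rfl⟩
      exact ⟨_, (weight_eq_one_iff _).2 ⟨k, rfl⟩, rfl⟩
  set Q : SiteLabel d n → QOp d n := fun k => pauliN d n (siteIndex k) with hQ
  have hortho : ∀ k l, ((Q k)ᴴ * Q l).trace = if k = l then (d : ℂ) ^ n else 0 := by
    intro k l
    simp only [hQ, trace_conjTranspose_pauliN_mul, siteIndex_injective.eq_iff]
  have hexp : ∀ k, ∃ c : SiteLabel d n → ℂ, ∑ l, c l • Q l = Uᴴ * Q k * U := by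
    intro k
    rw [← Submodule.mem_span_range_iff_exists_fun, ← hset]
    exact h _ ((weight_eq_one_iff _).2 ⟨k, rfl⟩)
  obtain ⟨M, hM⟩ : ∃ M : Matrix (SiteLabel d n) (SiteLabel d n) ℂ,
      ∀ k, ∑ l, M k l • Q l = Uᴴ * Q k * U := by
    choose M hM using hexp
    exact ⟨Matrix.of M, hM⟩
  have hMM : Mᴴ * M = 1 := by
    rw [mul_eq_one_comm]
    ext k k'
    have h1 : ((Uᴴ * Q k' * U)ᴴ * (Uᴴ * Q k * U)).trace = ((Q k')ᴴ * Q k).trace := by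
      have : (Uᴴ * Q k' * U)ᴴ * (Uᴴ * Q k * U) = Uᴴ * ((Q k')ᴴ * (U * Uᴴ) * Q k * U) := by
        simp only [Matrix.conjTranspose_mul, Matrix.conjTranspose_conjTranspose, Matrix.mul_assoc]
      rw [this, hU', Matrix.mul_one, Matrix.trace_mul_comm, Matrix.mul_assoc, hU', Matrix.mul_one]
    rw [← hM, ← hM, hortho] at h1
    simp only [Matrix.conjTranspose_sum, Matrix.conjTranspose_smul, Finset.sum_mul,
      Finset.mul_sum, Matrix.trace_sum, Matrix.smul_mul, Matrix.mul_smul, Matrix.trace_smul,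
      smul_eq_mul, hortho, mul_ite, mul_zero, Finset.sum_ite_eq',
      Finset.mem_univ, if_true] at h1
    rw [Matrix.mul_apply, Matrix.one_apply]
    simp only [Matrix.conjTranspose_apply]
    apply mul_right_cancel₀ (pow_ne_zero n hd)
    rw [Finset.sum_mul, ite_mul, one_mul, zero_mul]
    simp only [@eq_comm _ k k']
    rw [← h1]
    refine Finset.sum_congr rfl fun l _ => ?_
    ring
  have hcomm : ∀ k, Q k * (U * O * Uᴴ) - U * O * Uᴴ * Q k =
      U * (∑ l, M k l • (Q l * O - O * Q l)) * Uᴴ := by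
    intro k
    have hin : ∑ l, M k l • (Q l * O - O * Q l) =
        (Uᴴ * Q k * U) * O - O * (Uᴴ * Q k * U) := by
      rw [← hM]
      simp only [smul_sub, Finset.sum_sub_distrib, Finset.sum_mul, Finset.mul_sum,
        Matrix.smul_mul, Matrix.mul_smul]
    have h1 : U * (Uᴴ * Q k * U * O) * Uᴴ = (U * Uᴴ) * (Q k * (U * O * Uᴴ)) := by
      simp only [Matrix.mul_assoc]
    have h2 : U * (O * (Uᴴ * Q k * U)) * Uᴴ = U * O * Uᴴ * Q k * (U * Uᴴ) := by
      simp only [Matrix.mul_assoc]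
    rw [hin, Matrix.mul_sub, Matrix.sub_mul, h1, h2, hU', Matrix.one_mul, Matrix.mul_one]
  have hfin : 2 * (d : ℝ) ^ 2 * influence d n (U * O * Uᴴ) = 2 * (d : ℝ) ^ 2 * influence d n O := by
    rw [← sum_sqNorm_commutator, ← sum_sqNorm_commutator,
      ← sum_sqNorm_mix hMM (fun l => Q l * O - O * Q l)]
    refine Finset.sum_congr rfl fun k _ => ?_
    change sqNorm d n (Q k * (U * O * Uᴴ) - U * O * Uᴴ * Q k) = _
    rw [hcomm, sqNorm_conj hU]
  refine mul_left_cancel₀ ?_ hfin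
  have : (d : ℝ) ≠ 0 := Nat.cast_ne_zero.2 (NeZero.ne d)
  positivity

/-- A unitary is stable (`CiS[U] = 0`) iff it maps weight-1 Paulis (in both directions)
into the linear span of weight-1 Paulis. -/
theorem cis_eq_zero_iff_weight_one (n d : ℕ) (hn : 1 ≤ n) (hd : 2 ≤ d) [NeZero d]
    (U : QOp d n) (hU : U ∈ Matrix.unitaryGroup (Fin n → Fin d) ℂ) :
    CiS d n U = 0 ↔
    ∀ a : Fin n → ZMod d × ZMod d, weight d n a = 1 →
      U * pauliN d n a * Uᴴ ∈
        Submodule.span ℂ {M : QOp d n | ∃ b, weight d n b = 1 ∧ M = pauliN d n b} ∧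
      Uᴴ * pauliN d n a * U ∈
        Submodule.span ℂ {M : QOp d n | ∃ b, weight d n b = 1 ∧ M = pauliN d n b} := by
  have hUl : Uᴴ * U = 1 := (Matrix.mem_unitaryGroup_iff' (A := U)).1 hU
  have hUr : U * Uᴴ = 1 := (Matrix.mem_unitaryGroup_iff (A := U)).1 hU
  constructor
  · intro h a ha
    have hI := influence_conjTranspose_pauliN d n a
    rw [ha, Nat.cast_one] at hI
    have hs := sqNorm_conjTranspose_pauliN d n a
    have hstar : (U * pauliN d n a * Uᴴ)ᴴ = U * (pauliN d n a)ᴴ * Uᴴ := by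
      simp [Matrix.mul_assoc]
    have hstar' : (Uᴴ * pauliN d n a * U)ᴴ = Uᴴ * (pauliN d n a)ᴴ * U := by
      simp [Matrix.mul_assoc]
    have hs' : sqNorm d n (Uᴴ * (pauliN d n a)ᴴ * U) = 1 := by
      rw [sqNorm_mul_right hUr, sqNorm_mul_left (by rwa [Matrix.conjTranspose_conjTranspose]), hs]
    constructor
    · apply mem_span_weight_one
      · rw [hstar, sqNorm_conj hUl, hs]
      · rw [Matrix.mul_assoc, Matrix.trace_mul_comm, Matrix.mul_assoc, hUl, Matrix.mul_one,
          trace_pauliN_eq_zero d n ha]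
      · rw [hstar, influence_conj_eq_of_CiS_eq_zero hUl h hs, hI]
    · apply mem_span_weight_one
      · rw [hstar', hs']
      · rw [Matrix.mul_assoc, Matrix.trace_mul_comm, Matrix.mul_assoc, hUr, Matrix.mul_one,
          trace_pauliN_eq_zero d n ha]
      · rw [hstar', ← influence_conj_eq_of_CiS_eq_zero hUl h hs']
        have : U * (Uᴴ * (pauliN d n a)ᴴ * U) * Uᴴ = (U * Uᴴ) * (pauliN d n a)ᴴ * (U * Uᴴ) := by
          simp only [Matrix.mul_assoc]
        rw [this, hUr, Matrix.one_mul, Matrix.mul_one, hI]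
  · intro h
    have hzero : ∀ x ∈ {x : ℝ | ∃ O : QOp d n, l2norm d n O = 1 ∧
        x = |influence d n (U * O * Uᴴ) - influence d n O|}, x = 0 := by
      rintro _ ⟨O, -, rfl⟩
      rw [influence_conj_eq hUl (fun a ha => (h a ha).2), sub_self, abs_zero]
    exact le_antisymm (Real.sSup_nonpos fun x hx => (hzero x hx).le)
      (Real.sSup_nonneg fun x hx => (hzero x hx).ge)

end QC
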